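/- Let C be a set of 4-dimensional subspaces of F_2^8 whose pairwise subspace distances are all at least 6, and suppose |C| ≥ 273. Then there exists a point P̄ (a 1-dimensional subspace) with #{U ∈ C : P̄ ≤ U} = 17 and there exists a hyperplane H̄ (a 7-dimensional subspace) with #{U ∈ C : U ≤ H̄} = 17. -/

import Mathlib

open Module

/-- The subspace distance `d_s(U,W) = dim(U + W) - dim(U ∩ W)`. -/
noncomputable def sDist {K V : Type*} [DivisionRing K] [AddCommGroup V] [Module K V]
    (U W : Submodule K V) : ℕ :=
  finrank K ↥(U ⊔ W) - finrank K ↥(U ⊓ W)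

section BinaryCodes

variable {V : Type*} [AddCommGroup V] [Module (ZMod 2) V] [Fintype V]

open Classical in
/-- A subspace of dimension `n` over `F_2` has `2 ^ n` vectors. -/
lemma card_filter_mem_submodule (U : Submodule (ZMod 2) V) :
    (Finset.univ.filter (· ∈ U)).card = 2 ^ finrank (ZMod 2) U := by
  have h := Module.card_eq_pow_finrank (K := ZMod 2) (V := U)
  rw [ZMod.card] at h
  rw [← h, Fintype.card_subtype]

open Classical in
/-- A linear functional is nonzero on either none or exactly half of the vectors of a subspace. -/
lemma two_pow_dvd_card_filter_apply_ne_zero {n : ℕ} (U : Submodule (ZMod 2) V)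
    (hU : finrank (ZMod 2) U = n + 1) (f : Dual (ZMod 2) V) :
    2 ^ n ∣ (Finset.univ.filter fun x => x ∈ U ∧ f x ≠ 0).card := by
  have hsplit := Finset.card_filter_add_card_filter_not
    (s := Finset.univ.filter (· ∈ U)) (fun x => f x = 0)
  have hker : Finset.filter (fun x => f x = 0) (Finset.univ.filter (· ∈ U)) =
      Finset.univ.filter (· ∈ U ⊓ LinearMap.ker f) := by
    ext x; simp
  rw [hker, card_filter_mem_submodule, card_filter_mem_submodule, hU, Finset.filter_filter]
    at hsplit
  have hdim : n ≤ finrank (ZMod 2) ↥(U ⊓ LinearMap.ker f) := by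
    have h₁ := Submodule.finrank_sup_add_finrank_inf_eq U (LinearMap.ker f)
    have h₂ := LinearMap.finrank_range_add_finrank_ker f
    have h₃ := Submodule.finrank_le (LinearMap.range f)
    have h₄ := Submodule.finrank_le (U ⊔ LinearMap.ker f)
    rw [finrank_self] at h₃
    omega
  exact (Nat.dvd_add_right (pow_dvd_pow 2 hdim)).mp
    (hsplit ▸ pow_dvd_pow 2 (Nat.le_succ n))

/-- Two subspaces over `F_2` meeting in dimension at most `1` share at most one nonzero vector. -/
lemma eq_of_mem_inf_of_finrank_inf_le_one {U W : Submodule (ZMod 2) V}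
    (h : finrank (ZMod 2) ↥(U ⊓ W) ≤ 1) {x y : V} (hx : x ∈ U ⊓ W) (hy : y ∈ U ⊓ W)
    (hx0 : x ≠ 0) (hy0 : y ≠ 0) : x = y := by
  classical
  by_contra hxy
  have hsub : ({0, x, y} : Finset V) ⊆ Finset.univ.filter (· ∈ U ⊓ W) := by
    intro z hz
    simp only [Finset.mem_insert, Finset.mem_singleton] at hz
    rcases hz with rfl | rfl | rfl
    · simp
    · simpa using hx
    · simpa using hy
  have hcard := Finset.card_le_card hsub
  rw [card_filter_mem_submodule, Finset.card_eq_three.mpr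
    ⟨0, x, y, hx0.symm, hy0.symm, hxy, rfl⟩] at hcard
  have := Nat.pow_le_pow_right two_pos h
  omega

/-- At most `17` four-dimensional subspaces of `F_2^8` through a common nonzero vector
can pairwise meet in dimension at most `1`. -/
lemma card_le_seventeen_of_forall_mem (hV : finrank (ZMod 2) V = 8) {p : V} (hp : p ≠ 0)
    (S : Finset (Submodule (ZMod 2) V)) (hdim : ∀ U ∈ S, finrank (ZMod 2) U = 4)
    (hinf : ∀ U ∈ S, ∀ W ∈ S, U ≠ W → finrank (ZMod 2) ↥(U ⊓ W) ≤ 1)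
    (hmem : ∀ U ∈ S, p ∈ U) : S.card ≤ 17 := by
  classical
  by_contra! hS
  obtain ⟨T, hTS, hT⟩ := Finset.exists_subset_card_eq (n := 18) hS
  let A : Submodule (ZMod 2) V → Finset V := fun U => (Finset.univ.filter (· ∈ U)) \ {0, p}
  have hA : ∀ U ∈ T, (A U).card = 14 := by
    intro U hU
    have hsub : ({0, p} : Finset V) ⊆ Finset.univ.filter (· ∈ U) := by
      intro x hx
      simp only [Finset.mem_insert, Finset.mem_singleton] at hx
      rcases hx with rfl | rfl
      · simp
      · simpa using hmem U (hTS hU)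
    rw [Finset.card_sdiff_of_subset hsub, card_filter_mem_submodule, hdim U (hTS hU),
      Finset.card_pair hp.symm]
    norm_num
  have hdisj : (T : Set (Submodule (ZMod 2) V)).PairwiseDisjoint A := by
    intro U hU W hW hUW
    refine Finset.disjoint_left.mpr fun x hxU hxW => ?_
    simp only [A, Finset.mem_sdiff, Finset.mem_filter, Finset.mem_univ, true_and,
      Finset.mem_insert, Finset.mem_singleton, not_or] at hxU hxW
    exact hxU.2.2 (eq_of_mem_inf_of_finrank_inf_le_one
      (hinf U (hTS hU) W (hTS hW) hUW) ⟨hxU.1, hxW.1⟩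
      ⟨hmem U (hTS hU), hmem W (hTS hW)⟩ hxU.2.1 hp)
  have hunion : (T.biUnion A).card = 252 := by
    rw [Finset.card_biUnion hdisj, Finset.sum_congr rfl hA, Finset.sum_const, hT]
    rfl
  -- The two vectors lying on none of the eighteen subspaces.
  let R : Finset V := (Finset.univ \ {0, p}) \ T.biUnion A
  have hsubset : T.biUnion A ⊆ Finset.univ \ {0, p} := by
    intro x hx
    obtain ⟨U, -, hxU⟩ := Finset.mem_biUnion.mp hx
    exact Finset.mem_sdiff.mpr ⟨Finset.mem_univ x, (Finset.mem_sdiff.mp hxU).2⟩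
  have hcardV : Fintype.card V = 256 := by
    rw [Module.card_eq_pow_finrank (K := ZMod 2) (V := V), hV, ZMod.card]
    norm_num
  have hR : R.card = 2 := by
    rw [Finset.card_sdiff_of_subset hsubset, Finset.card_sdiff_of_subset (Finset.subset_univ _),
      Finset.card_univ, hcardV, hunion, Finset.card_pair hp.symm]
  obtain ⟨v, hv⟩ : R.Nonempty := Finset.card_pos.mp (by omega)
  have hvp : v ∉ Submodule.span (ZMod 2) {p} := by
    intro h
    obtain ⟨a, rfl⟩ := Submodule.mem_span_singleton.mp h
    have ha : a = 0 ∨ a = 1 := (by decide : ∀ b : ZMod 2, b = 0 ∨ b = 1) a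
    rcases ha with rfl | rfl <;> simp [R] at hv
  obtain ⟨f, hfv, hf⟩ := Submodule.exists_le_ker_of_notMem hvp
  have hfp : f p = 0 := hf (Submodule.mem_span_singleton_self p)
  have hAf : ∀ U ∈ T, 8 ∣ ((A U).filter fun x => f x ≠ 0).card := by
    intro U hU
    have h := two_pow_dvd_card_filter_apply_ne_zero (n := 3) U (hdim U (hTS hU)) f
    suffices heq : (A U).filter (fun x => f x ≠ 0) =
        Finset.univ.filter fun x => x ∈ U ∧ f x ≠ 0 by rwa [heq]
    ext x
    simp only [A, Finset.mem_filter, Finset.mem_sdiff, Finset.mem_univ, true_and,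
      Finset.mem_insert, Finset.mem_singleton, and_congr_left_iff, and_iff_left_iff_imp]
    rintro hx - (rfl | rfl)
    · exact hx (map_zero f)
    · exact hx hfp
  have hunionf : 8 ∣ ((T.biUnion A).filter fun x => f x ≠ 0).card := by
    rw [Finset.filter_biUnion, Finset.card_biUnion]
    · exact Finset.dvd_sum hAf
    · exact fun U hU W hW hUW => Finset.disjoint_filter_filter (hdisj hU hW hUW)
  have htotal : 8 ∣ (Finset.univ.filter fun x => f x ≠ 0).card := by
    have h := two_pow_dvd_card_filter_apply_ne_zero (n := 7) (⊤ : Submodule (ZMod 2) V)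
      (by rw [finrank_top, hV]) f
    simp only [Submodule.mem_top, true_and] at h
    exact dvd_trans (by norm_num) h
  have hsplit : (Finset.univ.filter fun x => f x ≠ 0).card =
      ((T.biUnion A).filter fun x => f x ≠ 0).card + (R.filter fun x => f x ≠ 0).card := by
    rw [← Finset.card_union_of_disjoint
      (Finset.disjoint_filter_filter Finset.disjoint_sdiff), ← Finset.filter_union,
      Finset.union_sdiff_of_subset hsubset]
    congr 1
    ext x
    simp only [Finset.mem_filter, Finset.mem_sdiff, Finset.mem_univ, true_and,
      Finset.mem_insert, Finset.mem_singleton, iff_and_self]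
    rintro hx (rfl | rfl)
    · exact hx (map_zero f)
    · exact hx hfp
  have hle : (R.filter fun x => f x ≠ 0).card ≤ 2 :=
    (Finset.card_filter_le _ _).trans_eq hR
  have hpos : 0 < (R.filter fun x => f x ≠ 0).card :=
    Finset.card_pos.mpr ⟨v, Finset.mem_filter.mpr ⟨hv, hfv⟩⟩
  omega

open Classical in
/-- Among at least `273` four-dimensional subspaces of `F_2^8`, more than `16` share some
nonzero vector. -/
lemma exists_sixteen_lt_card_filter_mem (hV : finrank (ZMod 2) V = 8)
    (S : Finset (Submodule (ZMod 2) V)) (hdim : ∀ U ∈ S, finrank (ZMod 2) U = 4)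
    (hcard : 273 ≤ S.card) : ∃ p : V, p ≠ 0 ∧ 16 < (S.filter (p ∈ ·)).card := by
  by_contra! h
  have hcount := Finset.sum_card_bipartiteAbove_eq_sum_card_bipartiteBelow
    (s := Finset.univ.erase (0 : V)) (t := S) (fun x U => x ∈ U)
  have hU : ∀ U ∈ S,
      ((Finset.univ.erase (0 : V)).bipartiteBelow (fun x U => x ∈ U) U).card = 15 := by
    intro U hU
    rw [Finset.bipartiteBelow, Finset.filter_erase, Finset.card_erase_of_mem (by simp),
      card_filter_mem_submodule, hdim U hU]
    norm_num
  have hle : ∑ x ∈ Finset.univ.erase (0 : V), (S.bipartiteAbove (fun x U => x ∈ U) x).card ≤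
      (Finset.univ.erase (0 : V)).card • 16 :=
    Finset.sum_le_card_nsmul _ _ _ fun x hx => h x (Finset.ne_of_mem_erase hx)
  rw [hcount, Finset.sum_congr rfl hU, Finset.sum_const, Finset.card_erase_of_mem (by simp),
    Finset.card_univ, Module.card_eq_pow_finrank (K := ZMod 2) (V := V), hV, ZMod.card,
    smul_eq_mul, smul_eq_mul] at hle
  omega

end BinaryCodes

/-- At least `273` four-dimensional subspaces of `F_2^8` pairwise meeting in dimension at most `1`
admit a point on exactly `17` of them. -/
lemma exists_point_ncard_eq_seventeen {V : Type*} [AddCommGroup V] [Module (ZMod 2) V] [Finite V]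
    (hV : finrank (ZMod 2) V = 8) (C : Set (Submodule (ZMod 2) V))
    (hdim : ∀ U ∈ C, finrank (ZMod 2) U = 4)
    (hinf : ∀ U ∈ C, ∀ W ∈ C, U ≠ W → finrank (ZMod 2) ↥(U ⊓ W) ≤ 1)
    (hcard : 273 ≤ C.ncard) :
    ∃ P : Submodule (ZMod 2) V, finrank (ZMod 2) P = 1 ∧ {U ∈ C | P ≤ U}.ncard = 17 := by
  classical
  have := Fintype.ofFinite V
  have hC : C.Finite := Set.finite_of_ncard_pos (by omega)
  lift C to Finset (Submodule (ZMod 2) V) using hC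
  simp only [Finset.mem_coe, Set.ncard_coe_finset] at hdim hinf hcard ⊢
  obtain ⟨p, hp, hlt⟩ := exists_sixteen_lt_card_filter_mem hV C hdim hcard
  have hle := card_le_seventeen_of_forall_mem hV hp (C.filter (p ∈ ·))
    (fun U hU => hdim U (Finset.mem_filter.mp hU).1)
    (fun U hU W hW => hinf U (Finset.mem_filter.mp hU).1 W (Finset.mem_filter.mp hW).1)
    (fun U hU => (Finset.mem_filter.mp hU).2)
  refine ⟨Submodule.span (ZMod 2) {p}, finrank_span_singleton hp, ?_⟩
  simp only [Submodule.span_singleton_le_iff_mem]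
  rw [← Finset.coe_filter, Set.ncard_coe_finset]
  omega

/-- At least `273` four-dimensional subspaces of `F_2^8` pairwise meeting in dimension at most `1`
admit a hyperplane containing exactly `17` of them. -/
lemma exists_hyperplane_ncard_eq_seventeen {V : Type*} [AddCommGroup V] [Module (ZMod 2) V]
    [Finite V] (hV : finrank (ZMod 2) V = 8) (C : Set (Submodule (ZMod 2) V))
    (hdim : ∀ U ∈ C, finrank (ZMod 2) U = 4)
    (hinf : ∀ U ∈ C, ∀ W ∈ C, U ≠ W → finrank (ZMod 2) ↥(U ⊓ W) ≤ 1)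
    (hcard : 273 ≤ C.ncard) :
    ∃ H : Submodule (ZMod 2) V, finrank (ZMod 2) H = 7 ∧ {U ∈ C | U ≤ H}.ncard = 17 := by
  have hinj : Function.Injective
      (Submodule.dualAnnihilator : Submodule (ZMod 2) V → Submodule (ZMod 2) (Dual (ZMod 2) V)) :=
    fun _ _ h => Subspace.dualAnnihilator_inj.mp h
  have : Finite (Dual (ZMod 2) V) := Module.finite_of_finite (ZMod 2)
  obtain ⟨P, hP, hPcard⟩ := exists_point_ncard_eq_seventeen
    (V := Dual (ZMod 2) V) (Subspace.dual_finrank_eq.trans hV) (Submodule.dualAnnihilator '' C)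
    (by
      rintro _ ⟨U, hU, rfl⟩
      have := Subspace.finrank_add_finrank_dualAnnihilator_eq U
      have := hdim U hU
      omega)
    (by
      rintro _ ⟨U, hU, rfl⟩ _ ⟨W, hW, rfl⟩ hUW
      rw [← Submodule.dualAnnihilator_sup_eq]
      have := Subspace.finrank_add_finrank_dualAnnihilator_eq (U ⊔ W)
      have := Submodule.finrank_sup_add_finrank_inf_eq U W
      have := hinf U hU W hW (fun h => hUW (h ▸ rfl))
      have := hdim U hU
      have := hdim W hW
      omega)
    (by rwa [Set.ncard_image_of_injective C hinj])
  refine ⟨P.dualCoannihilator, ?_, ?_⟩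
  · have := Subspace.finrank_add_finrank_dualCoannihilator_eq P
    omega
  · rw [← hPcard, ← Set.ncard_image_of_injective _ hinj]
    congr 1
    ext W
    simp only [Set.mem_image, Set.mem_ofPred_eq]
    constructor
    · rintro ⟨U, ⟨hU, hUP⟩, rfl⟩
      exact ⟨⟨U, hU, rfl⟩, Submodule.le_dualAnnihilator_iff_le_dualCoannihilator.mpr hUP⟩
    · rintro ⟨⟨U, hU, rfl⟩, hPU⟩
      exact ⟨U, ⟨hU, Submodule.le_dualAnnihilator_iff_le_dualCoannihilator.mp hPU⟩, rfl⟩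

/-- If an `(8,N,6;4)_2` constant dimension code has `N ≥ 273`, then some point lies on
exactly `17` codewords and some hyperplane contains exactly `17` codewords. -/
theorem exists_full_point_and_hyperplane
    (C : Set (Submodule (ZMod 2) (Fin 8 → ZMod 2)))
    (hdim : ∀ U ∈ C, finrank (ZMod 2) ↥U = 4)
    (hdist : ∀ U ∈ C, ∀ W ∈ C, U ≠ W → 6 ≤ sDist U W)
    (hcard : 273 ≤ C.ncard) :
    (∃ P : Submodule (ZMod 2) (Fin 8 → ZMod 2), finrank (ZMod 2) ↥P = 1 ∧
      {U ∈ C | P ≤ U}.ncard = 17) ∧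
    (∃ H : Submodule (ZMod 2) (Fin 8 → ZMod 2), finrank (ZMod 2) ↥H = 7 ∧
      {U ∈ C | U ≤ H}.ncard = 17) := by
  have hV : finrank (ZMod 2) (Fin 8 → ZMod 2) = 8 := by simp
  have hinf : ∀ U ∈ C, ∀ W ∈ C, U ≠ W → finrank (ZMod 2) ↥(U ⊓ W) ≤ 1 := by
    intro U hU W hW hUW
    have h₁ := hdist U hU W hW hUW
    have h₂ := Submodule.finrank_sup_add_finrank_inf_eq U W
    rw [sDist] at h₁
    rw [hdim U hU, hdim W hW] at h₂
    omega
  exact ⟨exists_point_ncard_eq_seventeen hV C hdim hinf hcard,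
    exists_hyperplane_ncard_eq_seventeen hV C hdim hinf hcard⟩
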